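/- Let P be a finite set of primes and G = SL₂(ℝ) × ∏_{p∈P} SL₂(ℚ_p). Then Δ(SL₂(ℤ[1/P])) is a discrete subgroup of G, and there exists a Borel probability measure on the space of right cosets Δ(SL₂(ℤ[1/P]))\G that is invariant under right translation by every element of G; that is, SL₂(ℤ[1/P]) (diagonally embedded) is a lattice in G. -/

import Mathlib

/-!
`SL₂(ℤ[1/P])`, diagonally embedded, is a lattice in
`G = SL₂(ℝ) × ∏_{p ∈ P} SL₂(ℚ_p)`.
-/

set_option linter.unusedSectionVars false

noncomputable section
open MeasureTheory Matrix

instance (p : ℕ) [Fact p.Prime] : MeasurableSpace ℚ_[p] := borel _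
instance (p : ℕ) [Fact p.Prime] : BorelSpace ℚ_[p] := ⟨rfl⟩

instance (p : ℕ) [Fact p.Prime] : MeasurableSpace (Matrix (Fin 2) (Fin 2) ℚ_[p]) :=
  inferInstanceAs (MeasurableSpace ((Fin 2) → (Fin 2) → ℚ_[p]))

instance (p : ℕ) [Fact p.Prime] :
    MeasurableSpace (Matrix.SpecialLinearGroup (Fin 2) ℚ_[p]) :=
  inferInstanceAs (MeasurableSpace {A : Matrix (Fin 2) (Fin 2) ℚ_[p] // A.det = 1})

instance : MeasurableSpace (Matrix (Fin 2) (Fin 2) ℝ) :=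
  inferInstanceAs (MeasurableSpace ((Fin 2) → (Fin 2) → ℝ))

instance : MeasurableSpace (Matrix.SpecialLinearGroup (Fin 2) ℝ) :=
  inferInstanceAs (MeasurableSpace {A : Matrix (Fin 2) (Fin 2) ℝ // A.det = 1})


instance (p : ℕ) [Fact p.Prime] :
    TopologicalSpace (Matrix.SpecialLinearGroup (Fin 2) ℚ_[p]) :=
  inferInstanceAs (TopologicalSpace {A : Matrix (Fin 2) (Fin 2) ℚ_[p] // A.det = 1})

instance : TopologicalSpace (Matrix.SpecialLinearGroup (Fin 2) ℝ) :=
  inferInstanceAs (TopologicalSpace {A : Matrix (Fin 2) (Fin 2) ℝ // A.det = 1})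

variable (P : Finset ℕ) [∀ p : ↥P, Fact (Nat.Prime (p : ℕ))]

/-- `ℚ_P = ℝ × ∏_{p ∈ P} ℚ_p`. -/
abbrev QP : Type := ℝ × ((p : ↥P) → ℚ_[(p : ℕ)])

/-- The subring `ℤ[1/P] ⊆ ℚ` generated by `ℤ` and the inverses of the primes in `P`. -/
def ZinvP : Subring ℚ := Subring.closure {x : ℚ | ∃ p ∈ P, x = ((p : ℚ))⁻¹}

/-- The diagonal embedding `ℚ → ℚ_P`. -/
def ratDiag : ℚ →+* QP P :=
  RingHom.prod (Rat.castHom ℝ) (Pi.ringHom fun p => Rat.castHom ℚ_[(p : ℕ)])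

/-- The lattice `Δ(ℤ[1/P]) ⊆ ℚ_P`. -/
def latP : AddSubgroup (QP P) :=
  (((ratDiag P).comp (ZinvP P).subtype).toAddMonoidHom).range

/-- The solenoid `𝕋_P = ℚ_P / Δ(ℤ[1/P])`. -/
abbrev TP := QP P ⧸ latP P

/-- `G = SL₂(ℝ) × ∏_{p ∈ P} SL₂(ℚ_p)`. -/
abbrev GP : Type :=
  Matrix.SpecialLinearGroup (Fin 2) ℝ ×
    ((p : ↥P) → Matrix.SpecialLinearGroup (Fin 2) ℚ_[(p : ℕ)])

/-- The diagonal embedding `SL₂(ℚ) → G`. -/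
def sl2Diag : Matrix.SpecialLinearGroup (Fin 2) ℚ →* GP P :=
  MonoidHom.prod (Matrix.SpecialLinearGroup.map (Rat.castHom ℝ))
    (Pi.monoidHom fun p => Matrix.SpecialLinearGroup.map (Rat.castHom ℚ_[(p : ℕ)]))

/-- The lattice `Δ(SL₂(ℤ[1/P])) ⊆ G`. -/
def ΓP : Subgroup (GP P) :=
  ((sl2Diag P).comp (Matrix.SpecialLinearGroup.map (ZinvP P).subtype)).range

/-- The space `X_P` of right cosets `Δ(SL₂(ℤ[1/P]))·g` in `G`. -/
abbrev XP := Quotient (QuotientGroup.rightRel (ΓP P))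

/-- Right translation by `g ∈ G` on `X_P`. -/
def rightTP (g : GP P) : XP P → XP P :=
  Quotient.map (· * g) (by
    intro a b hab
    have h := QuotientGroup.rightRel_apply.mp hab
    exact QuotientGroup.rightRel_apply.mpr (by simpa [mul_assoc] using h))

section general

open scoped Pointwise

variable {G : Type*} [Group G] [TopologicalSpace G] [IsTopologicalGroup G]

/-- A discrete subgroup admits a neighbourhood of `1` whose translates have no repetitions. -/
theorem Subgroup.exists_isOpen_mul_mem_imp_eq_one (Γ : Subgroup G) [DiscreteTopology Γ] :
    ∃ U : Set G, IsOpen U ∧ (1 : G) ∈ U ∧ ∀ γ ∈ Γ, ∀ u ∈ U, γ * u ∈ U → γ = 1 := by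
  obtain ⟨V, hV, hV1⟩ := isOpen_induced_iff.mp (isOpen_discrete ({1} : Set Γ))
  have h1 : (1 : G) ∈ V := by
    have : (1 : Γ) ∈ (Subtype.val ⁻¹' V : Set Γ) := by rw [hV1]; rfl
    exact this
  have hc : Continuous fun p : G × G => p.1 * p.2⁻¹ := by fun_prop
  obtain ⟨A, B, hA, hB, hA1, hB1, hAB⟩ :=
    isOpen_prod_iff.mp (hV.preimage hc) 1 1 (by simpa using h1)
  refine ⟨A ∩ B, hA.inter hB, ⟨hA1, hB1⟩, fun γ hγ u hu hγu => ?_⟩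
  have : γ ∈ V := by simpa using hAB (Set.mk_mem_prod hγu.1 hu.2)
  have h2 : (⟨γ, hγ⟩ : Γ) ∈ (Subtype.val ⁻¹' V : Set Γ) := this
  rw [hV1] at h2
  exact congrArg Subtype.val h2

variable [SecondCountableTopology G] [MeasurableSpace G] [BorelSpace G]

/-- A discrete subgroup of a second countable group has a Borel set of coset representatives. -/
theorem Subgroup.exists_measurableSet_existsUnique_mul_mem (Γ : Subgroup G) [DiscreteTopology Γ]
    [Countable Γ] :
    ∃ D : Set G, MeasurableSet D ∧ ∀ x : G, ∃! γ : Γ, γ • x ∈ D := by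
  obtain ⟨U, hUo, hU1, hU⟩ := Γ.exists_isOpen_mul_mem_imp_eq_one
  let s : ℕ → G := TopologicalSpace.denseSeq G
  let F : ℕ → Set G := fun n => (fun x => x * (s n)⁻¹) ⁻¹' U
  have hFo : ∀ n, IsOpen (F n) := fun n => hUo.preimage (by fun_prop)
  have hF : ∀ n, ∀ x ∈ F n, ∀ γ : Γ, γ • x ∈ F n → γ = 1 := by
    intro n x hx γ hγ
    have : (γ : G) = 1 := hU γ γ.2 _ hx (by simpa [F, Subgroup.smul_def, mul_assoc] using hγ)
    exact_mod_cast this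
  have hcov : ∀ x : G, ∃ n, x ∈ F n := by
    intro x
    obtain ⟨n, hn⟩ := (TopologicalSpace.denseRange_denseSeq G).exists_mem_open
      (hUo.preimage (by fun_prop : Continuous fun y : G => x * y⁻¹)) ⟨x, by simpa using hU1⟩
    exact ⟨n, hn⟩
  let E : ℕ → Set G := fun n => {x | ∃ γ : Γ, γ • x ∈ F n}
  have hEo : ∀ n, IsOpen (E n) := by
    intro n
    have : E n = ⋃ γ : Γ, (fun x => (γ : G) * x) ⁻¹' F n := by
      ext x; simp [E, Subgroup.smul_def]
    rw [this]
    exact isOpen_iUnion fun γ => (hFo n).preimage (by fun_prop)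
  have hEinv : ∀ n (γ : Γ) x, γ • x ∈ E n ↔ x ∈ E n := by
    intro n γ x
    constructor
    · rintro ⟨δ, hδ⟩
      exact ⟨δ * γ, by rwa [mul_smul]⟩
    · rintro ⟨δ, hδ⟩
      exact ⟨δ * γ⁻¹, by rwa [mul_smul, inv_smul_smul]⟩
  refine ⟨⋃ n, F n \ ⋃ m ∈ Set.Iio n, E m, MeasurableSet.iUnion fun n =>
    (hFo n).measurableSet.diff (MeasurableSet.biUnion (Set.to_countable _) fun m _ =>
      (hEo m).measurableSet), fun x => ?_⟩
  have hex : ∃ n, x ∈ E n := (hcov x).imp fun n hn => ⟨1, by simpa using hn⟩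
  classical
  obtain ⟨γ, hγ⟩ := Nat.find_spec hex
  have key : ∀ δ : Γ, δ • x ∈ (⋃ n, F n \ ⋃ m ∈ Set.Iio n, E m) ↔ δ • x ∈ F (Nat.find hex) := by
    intro δ
    simp only [Set.mem_iUnion, Set.mem_sdiff, Set.mem_Iio, exists_prop, not_exists, not_and, hEinv]
    constructor
    · rintro ⟨n, hn, hlt⟩
      have : Nat.find hex = n := by
        rw [Nat.find_eq_iff]
        exact ⟨⟨δ, hn⟩, hlt⟩
      rwa [this]
    · intro h
      exact ⟨_, h, fun m hm => Nat.find_min hex hm⟩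
  refine ⟨γ, (key γ).2 hγ, fun δ hδ => ?_⟩
  have := hF _ _ hγ (δ * γ⁻¹) (by rw [mul_smul, inv_smul_smul]; exact (key δ).1 hδ)
  exact mul_inv_eq_one.mp this

/-- A discrete subgroup of a second countable unimodular group which has a set of representatives
of finite measure admits an invariant probability measure on its coset space. -/
theorem Subgroup.exists_isProbabilityMeasure_map_eq (Γ : Subgroup G) [DiscreteTopology Γ]
    (ν : Measure G) [ν.IsMulLeftInvariant] [ν.IsMulRightInvariant] (hν : ν ≠ 0)
    {F : Set G} (hFν : ν F ≠ ⊤) (hcov : ∀ g : G, ∃ γ ∈ Γ, γ * g ∈ F) :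
    ∃ μ : Measure (Quotient (QuotientGroup.rightRel Γ)), IsProbabilityMeasure μ ∧
      ∀ (g : G) (T : Quotient (QuotientGroup.rightRel Γ) → Quotient (QuotientGroup.rightRel Γ)),
        (∀ x : G, T (Quotient.mk (QuotientGroup.rightRel Γ) x) = Quotient.mk _ (x * g)) →
        Measure.map T μ = μ := by
  have : Countable Γ := TopologicalSpace.separableSpace_iff_countable.mp inferInstance
  obtain ⟨D, hDm, hD⟩ := Γ.exists_measurableSet_existsUnique_mul_mem
  have hfund : IsFundamentalDomain Γ D ν := .mk' hDm.nullMeasurableSet hD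
  have hD0 : ν D ≠ 0 := hfund.measure_ne_zero hν
  have hDtop : ν D ≠ ⊤ := by
    refine ne_top_of_le_ne_top hFν ?_
    rw [hfund.measure_eq_tsum F]
    refine (measure_mono fun x hx => ?_).trans (measure_iUnion_le _)
    obtain ⟨γ, hγ, hx'⟩ := hcov x
    exact Set.mem_iUnion.2 ⟨(⟨γ, hγ⟩ : Γ)⁻¹, by
      rw [Set.mem_smul_set_iff_inv_smul_mem, inv_inv]; exact hx', hx⟩
  let π : G → Quotient (QuotientGroup.rightRel Γ) := Quotient.mk (QuotientGroup.rightRel Γ)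
  have hπ : Measurable π := fun _ h => h
  refine ⟨(ν D)⁻¹ • Measure.map π (ν.restrict D), ⟨?_⟩, fun g T hT => ?_⟩
  · rw [Measure.smul_apply, Measure.map_apply hπ .univ]
    simp [ENNReal.inv_mul_cancel hD0 hDtop]
  have hmul : Measurable fun x : G => x * g := measurable_mul_const g
  have hTπ : T ∘ π = π ∘ fun x => x * g := funext hT
  have hTm : Measurable T := by
    refine measurable_from_quotient.2 ?_
    exact hTπ ▸ hπ.comp hmul
  rw [Measure.map_smul, Measure.map_map hTm hπ]
  congr 1
  ext A hA
  let D' : Set G := (fun x => x * g⁻¹) ⁻¹' D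
  have hD'm : MeasurableSet D' := measurable_mul_const g⁻¹ hDm
  have hfund' : IsFundamentalDomain Γ D' ν := .mk' hD'm.nullMeasurableSet fun x => by
    simpa [D', Subgroup.smul_def, mul_assoc] using hD (x * g⁻¹)
  rw [hTπ, Measure.map_apply (hπ.comp hmul) hA, Measure.map_apply hπ hA,
    Measure.restrict_apply (hπ.comp hmul hA), Measure.restrict_apply (hπ hA)]
  have hinv : ∀ γ : Γ, (fun x => γ • x) ⁻¹' (π ⁻¹' A) = π ⁻¹' A := fun γ => by
    ext x
    have : π (γ • x) = π x := Quotient.sound (QuotientGroup.rightRel_apply.2 (by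
      simp [Subgroup.smul_def]))
    simp [this]
  rw [hfund.measure_set_eq hfund' (hπ hA) hinv, ← measure_preimage_mul_right ν g (π ⁻¹' A ∩ D')]
  congr 1
  ext x
  simp [D']

end general

section unipotent

/-- The upper unipotent matrix with entry `x`. -/
def upperUnipotent {R : Type*} [CommRing R] (x : R) : SpecialLinearGroup (Fin 2) R :=
  ⟨!![1, x; 0, 1], by simp⟩

/-- The lower unipotent matrix with entry `x`. -/
def lowerUnipotent {R : Type*} [CommRing R] (x : R) : SpecialLinearGroup (Fin 2) R :=
  ⟨!![1, 0; x, 1], by simp⟩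

/-- The diagonal matrix with entries `t` and `t⁻¹`. -/
def diagUnit {R : Type*} [CommRing R] (t : Rˣ) : SpecialLinearGroup (Fin 2) R :=
  ⟨!![(t : R), 0; 0, ((t⁻¹ : Rˣ) : R)], by simp⟩

@[simp]
theorem coe_upperUnipotent {R : Type*} [CommRing R] (x : R) :
    (upperUnipotent x : Matrix (Fin 2) (Fin 2) R) = !![1, x; 0, 1] := rfl

@[simp]
theorem coe_lowerUnipotent {R : Type*} [CommRing R] (x : R) :
    (lowerUnipotent x : Matrix (Fin 2) (Fin 2) R) = !![1, 0; x, 1] := rfl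

@[simp]
theorem coe_diagUnit {R : Type*} [CommRing R] (t : Rˣ) :
    (diagUnit t : Matrix (Fin 2) (Fin 2) R) = !![(t : R), 0; 0, ((t⁻¹ : Rˣ) : R)] := rfl

@[simp]
theorem map_upperUnipotent {R S : Type*} [CommRing R] [CommRing S] (f : R →+* S) (x : R) :
    SpecialLinearGroup.map f (upperUnipotent x) = upperUnipotent (f x) := by
  ext i j
  fin_cases i <;> fin_cases j <;> simp [SpecialLinearGroup.map_apply_coe]

@[simp]
theorem map_lowerUnipotent {R S : Type*} [CommRing R] [CommRing S] (f : R →+* S) (x : R) :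
    SpecialLinearGroup.map f (lowerUnipotent x) = lowerUnipotent (f x) := by
  ext i j
  fin_cases i <;> fin_cases j <;> simp [SpecialLinearGroup.map_apply_coe]

end unipotent

section siegel

open UpperHalfPlane

theorem coe_upperUnipotent_smul (x : ℝ) (z : ℍ) :
    ((upperUnipotent x • z : ℍ) : ℂ) = z + x := by
  simp [coe_specialLinearGroup_apply]

theorem coe_diagUnit_smul (t : ℝˣ) (z : ℍ) :
    ((diagUnit t • z : ℍ) : ℂ) = ((t : ℝ) ^ 2 : ℝ) * z := by
  have : ((t : ℝ) : ℂ) ≠ 0 := by exact_mod_cast t.ne_zero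
  simp [coe_specialLinearGroup_apply]
  field_simp

/-- The half-open box `[a, b) × [c, d]` in the upper half-plane. -/
def upperBox (a b c d : ℝ) : Set ℍ := {z | z.re ∈ Set.Ico a b ∧ z.im ∈ Set.Icc c d}

theorem measurableSet_upperBox (a b c d : ℝ) : MeasurableSet (upperBox a b c d) :=
  (measurableSet_Ico.preimage continuous_re.measurable).inter
    (measurableSet_Icc.preimage continuous_im.measurable)

theorem preimage_upperUnipotent_smul_upperBox (x a b c d : ℝ) :
    (fun z : ℍ => upperUnipotent x • z) ⁻¹' upperBox a b c d = upperBox (a - x) (b - x) c d := by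
  ext z
  have h := coe_upperUnipotent_smul x z
  have hre : (upperUnipotent x • z).re = z.re + x := by simpa using congrArg Complex.re h
  have him : (upperUnipotent x • z).im = z.im := by simpa using congrArg Complex.im h
  simp [upperBox, hre, him, lt_sub_iff_add_lt]

theorem preimage_diagUnit_smul_upperBox (t : ℝˣ) (a b c d : ℝ) :
    (fun z : ℍ => diagUnit t • z) ⁻¹' upperBox a b c d =
      upperBox (a / t ^ 2) (b / t ^ 2) (c / t ^ 2) (d / t ^ 2) := by
  ext z
  have h := coe_diagUnit_smul t z
  have hre : (diagUnit t • z).re = t ^ 2 * z.re :=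
    (congrArg Complex.re h).trans (Complex.re_ofReal_mul _ _)
  have him : (diagUnit t • z).im = t ^ 2 * z.im :=
    (congrArg Complex.im h).trans (Complex.im_ofReal_mul _ _)
  have ht : (0 : ℝ) < (t : ℝ) ^ 2 := pow_two_pos_of_ne_zero t.ne_zero
  simp only [upperBox, Set.mem_preimage, Set.mem_ofPred_eq, Set.mem_Ico, Set.mem_Icc, hre, him,
    div_le_iff₀' ht, lt_div_iff₀' ht, le_div_iff₀' ht]

variable (m : Measure ℍ) [SMulInvariantMeasure (SpecialLinearGroup (Fin 2) ℝ) ℍ m]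

theorem measure_upperBox_sub (x a b c d : ℝ) :
    m (upperBox (a - x) (b - x) c d) = m (upperBox a b c d) := by
  rw [← preimage_upperUnipotent_smul_upperBox]
  exact SMulInvariantMeasure.measure_preimage_smul _ (measurableSet_upperBox a b c d)

theorem measure_upperBox_div (t : ℝˣ) (a b c d : ℝ) :
    m (upperBox (a / t ^ 2) (b / t ^ 2) (c / t ^ 2) (d / t ^ 2)) = m (upperBox a b c d) := by
  rw [← preimage_diagUnit_smul_upperBox]
  exact SMulInvariantMeasure.measure_preimage_smul _ (measurableSet_upperBox a b c d)

theorem nat_mul_measure_upperBox_le {n : ℕ} {b : ℝ} (hb : 0 ≤ b) (c d : ℝ) :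
    n * m (upperBox 0 b c d) ≤ m (upperBox 0 (n * b) c d) := by
  have hdisj : Pairwise (Function.onFun Disjoint fun k : ℕ =>
      upperBox (0 - -(k * b)) (b - -(k * b)) c d) := by
    refine (pairwise_disjoint_on _).2 fun k l hkl => Set.disjoint_left.2 fun z hz hz' => ?_
    have h1 := hz.1.2
    have h2 := hz'.1.1
    have : (k : ℝ) + 1 ≤ l := by exact_mod_cast hkl
    nlinarith
  calc n * m (upperBox 0 b c d)
      = ∑ k ∈ Finset.range n, m (upperBox (0 - -(k * b)) (b - -(k * b)) c d) := by
        simp only [measure_upperBox_sub]; simp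
    _ = m (⋃ k ∈ Finset.range n, upperBox (0 - -(k * b)) (b - -(k * b)) c d) :=
        (measure_biUnion_finset (fun _ _ _ _ h => hdisj h)
          fun _ _ => measurableSet_upperBox _ _ _ _).symm
    _ ≤ m (upperBox 0 (n * b) c d) := by
        refine measure_mono (Set.iUnion₂_subset fun k hk z hz => ⟨⟨?_, ?_⟩, hz.2⟩)
        · have := hz.1.1
          have : 0 ≤ k * b := by positivity
          linarith
        · have := hz.1.2
          have : (k : ℝ) + 1 ≤ n := by exact_mod_cast Finset.mem_range.1 hk
          nlinarith

theorem measure_upperBox_lt_top [IsFiniteMeasureOnCompacts m] (a b d : ℝ) {c : ℝ} (hc : 0 < c) :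
    m (upperBox a b c d) < ⊤ := by
  have hK : IsCompact (UpperHalfPlane.coe ⁻¹' (Set.Icc a b ×ℂ Set.Icc c d)) := by
    refine UpperHalfPlane.isOpenEmbedding_coe.isInducing.isCompact_preimage'
      (isCompact_Icc.reProdIm isCompact_Icc) fun z hz => ?_
    exact ⟨UpperHalfPlane.mk z (hc.trans_le hz.2.1), rfl⟩
  refine (measure_mono fun z hz => ?_).trans_lt hK.measure_lt_top
  exact ⟨⟨hz.1.1, hz.1.2.le⟩, hz.2⟩

/-- A measure on the upper half-plane which is invariant under `SL₂(ℝ)` and finite on compact sets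
gives finite mass to cuspidal strips. -/
theorem measure_strip_lt_top [IsFiniteMeasureOnCompacts m] {c : ℝ} (hc : 0 < c) :
    m {z | z.re ∈ Set.Ico 0 1 ∧ c ≤ z.im} < ⊤ := by
  have hle : ∀ j : ℕ, m (upperBox 0 1 (c * 4 ^ j) (c * 4 ^ (j + 1))) ≤
      m (upperBox 0 1 c (c * 4)) * (4⁻¹ : ENNReal) ^ j := by
    intro j
    have h := nat_mul_measure_upperBox_le m (n := 4 ^ j) (b := 1 / 4 ^ j) (by positivity) c (c * 4)
    have h2 := measure_upperBox_div m (Units.mk0 (2 ^ j : ℝ) (by positivity)) 0 1 (c * 4 ^ j)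
      (c * 4 ^ (j + 1))
    have h4 : ((2 : ℝ) ^ j) ^ 2 = 4 ^ j := by rw [← pow_mul, mul_comm, pow_mul]; norm_num
    have h5 : c * 4 ^ j / 4 ^ j = c := by field_simp
    have h6 : c * 4 ^ (j + 1) / 4 ^ j = c * 4 := by field_simp; ring
    rw [Units.val_mk0, h4, h5, h6, zero_div] at h2
    push_cast at h
    rw [mul_one_div_cancel (by positivity), h2] at h
    rw [← ENNReal.inv_pow, ← div_eq_mul_inv, ENNReal.le_div_iff_mul_le (by simp) (by simp),
      mul_comm]
    exact h
  calc m {z | z.re ∈ Set.Ico 0 1 ∧ c ≤ z.im}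
      ≤ m (⋃ j : ℕ, upperBox 0 1 (c * 4 ^ j) (c * 4 ^ (j + 1))) := by
        refine measure_mono fun z hz => ?_
        obtain ⟨j, hj, hj'⟩ := exists_nat_pow_near ((one_le_div hc).2 hz.2) (y := 4) (by norm_num)
        rw [le_div_iff₀' hc] at hj
        rw [div_lt_iff₀' hc] at hj'
        exact Set.mem_iUnion.2 ⟨j, hz.1, hj, hj'.le⟩
    _ ≤ ∑' j : ℕ, m (upperBox 0 1 c (c * 4)) * (4⁻¹ : ENNReal) ^ j :=
        (measure_iUnion_le _).trans (ENNReal.tsum_le_tsum hle)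
    _ < ⊤ := by
        rw [ENNReal.tsum_mul_left, ENNReal.tsum_geometric]
        refine ENNReal.mul_lt_top (measure_upperBox_lt_top m _ _ _ hc) (ENNReal.inv_lt_top.2 ?_)
        rw [tsub_pos_iff_lt, ENNReal.inv_lt_one]
        norm_num

/-- Every point of the upper half-plane can be moved by `SL₂(ℤ)` into a fixed cuspidal strip. -/
theorem exists_smul_mem_strip (z : ℍ) :
    ∃ γ : SpecialLinearGroup (Fin 2) ℤ,
      SpecialLinearGroup.map (Int.castRingHom ℝ) γ • z ∈
        {z : ℍ | z.re ∈ Set.Ico 0 1 ∧ 1 / 2 ≤ z.im} := by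
  obtain ⟨γ, hγ⟩ := ModularGroup.exists_smul_mem_fd z
  have him := ModularGroup.three_le_four_mul_im_sq_of_mem_fd hγ
  set w := γ • z with hw
  have hcoe : SpecialLinearGroup.map (Int.castRingHom ℝ) γ • z = w := rfl
  have hT : SpecialLinearGroup.map (Int.castRingHom ℝ) (upperUnipotent (-⌊w.re⌋)) =
      upperUnipotent (-(⌊w.re⌋ : ℝ)) := by simp
  refine ⟨upperUnipotent (-⌊w.re⌋) * γ, ?_⟩
  rw [map_mul, mul_smul, hcoe, hT]
  have h := coe_upperUnipotent_smul (-(⌊w.re⌋ : ℝ)) w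
  have hre : (upperUnipotent (-(⌊w.re⌋ : ℝ)) • w).re = w.re - ⌊w.re⌋ := by
    simpa [sub_eq_add_neg] using congrArg Complex.re h
  have him' : (upperUnipotent (-(⌊w.re⌋ : ℝ)) • w).im = w.im := by
    simpa using congrArg Complex.im h
  refine ⟨⟨?_, ?_⟩, ?_⟩
  · rw [hre]; linarith [Int.floor_le w.re]
  · rw [hre]; linarith [Int.lt_floor_add_one w.re]
  · rw [him']; nlinarith [w.im_pos]

end siegel

section perfect

variable {F : Type*} [Field F]

/-- Every element of `SL₂` of a field is a product of four unipotents of alternating types. -/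
theorem exists_eq_lower_mul_upper_mul_lower_mul_upper (g : SpecialLinearGroup (Fin 2) F) :
    ∃ s x y z : F, g =
      lowerUnipotent s * upperUnipotent x * lowerUnipotent y * upperUnipotent z := by
  have hdet : g 0 0 * g 1 1 - g 0 1 * g 1 0 = 1 := by
    rw [← Matrix.det_fin_two]; exact g.det_coe
  by_cases hc : g 1 0 = 0
  · have ha : g 0 0 ≠ 0 := by
      rintro ha
      simp [hc, ha] at hdet
    refine ⟨-1, (g 0 0 - 1) / g 0 0, g 0 0, (g 0 1 + g 1 1 - 1) / g 0 0, ?_⟩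
    rw [hc] at hdet
    ext i j
    fin_cases i <;> fin_cases j <;> simp [Matrix.mul_apply, hc] <;> field_simp <;>
      first | ring1 | linear_combination hdet | linear_combination -hdet
  · refine ⟨0, (g 0 0 - 1) / g 1 0, g 1 0, (g 1 1 - 1) / g 1 0, ?_⟩
    ext i j
    fin_cases i <;> fin_cases j <;> simp [Matrix.mul_apply] <;> field_simp <;>
      first | ring1 | linear_combination hdet | linear_combination -hdet

theorem MonoidHom.map_mul_mul_inv_mul_inv {G A : Type*} [Group G] [CommMonoid A] (χ : G →* A)
    (a b : G) : χ (a * b * a⁻¹ * b⁻¹) = 1 := by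
  rw [map_mul, map_mul, map_mul, mul_right_comm (χ a), mul_assoc, ← map_mul, ← map_mul]
  simp

/-- `SL₂` of a field of characteristic zero has no nontrivial abelian quotient. -/
theorem Matrix.SpecialLinearGroup.monoidHom_eq_one [CharZero F] {A : Type*} [CommMonoid A]
    (χ : SpecialLinearGroup (Fin 2) F →* A) : χ = 1 := by
  let t : Fˣ := Units.mk0 2 two_ne_zero
  have hu : ∀ x : F, χ (upperUnipotent x) = 1 := fun x => by
    have : upperUnipotent x =
        diagUnit t * upperUnipotent (x / 3) * (diagUnit t)⁻¹ * (upperUnipotent (x / 3))⁻¹ := by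
      rw [eq_mul_inv_iff_mul_eq, eq_mul_inv_iff_mul_eq]
      ext i j
      fin_cases i <;> fin_cases j <;> simp [Matrix.mul_apply, t]
      ring
    rw [this, χ.map_mul_mul_inv_mul_inv]
  have hl : ∀ x : F, χ (lowerUnipotent x) = 1 := fun x => by
    have : lowerUnipotent x =
        diagUnit t⁻¹ * lowerUnipotent (x / 3) * (diagUnit t⁻¹)⁻¹ * (lowerUnipotent (x / 3))⁻¹ := by
      rw [eq_mul_inv_iff_mul_eq, eq_mul_inv_iff_mul_eq]
      ext i j
      fin_cases i <;> fin_cases j <;> simp [Matrix.mul_apply, t]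
      ring
    rw [this, χ.map_mul_mul_inv_mul_inv]
  ext g
  obtain ⟨s, x, y, z, rfl⟩ := exists_eq_lower_mul_upper_mul_lower_mul_upper g
  simp [hu, hl]

/-- A Haar measure on a group without nontrivial abelian quotients is right invariant. -/
theorem MeasureTheory.Measure.isMulRightInvariant_of_modularCharacter_eq_one {G : Type*} [Group G]
    [TopologicalSpace G] [IsTopologicalGroup G] [LocallyCompactSpace G] [SecondCountableTopology G]
    [MeasurableSpace G] [BorelSpace G] (h : Measure.modularCharacter (G := G) = 1)
    (ν : Measure G) [ν.IsHaarMeasure] [ν.InnerRegular] : ν.IsMulRightInvariant where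
  map_mul_right_eq_self g := by
    have hg : Measure.modularCharacterFun g = 1 := DFunLike.congr_fun h g
    rw [Measure.map_right_mul_eq_modularCharacterFun_smul, hg, one_smul]

end perfect

section unipotentTopology

variable {R : Type*} [CommRing R] [TopologicalSpace R]

theorem continuous_upperUnipotent :
    Continuous (upperUnipotent : R → SpecialLinearGroup (Fin 2) R) := by
  refine continuous_induced_rng.2 (continuous_matrix fun i j => ?_)
  fin_cases i <;> fin_cases j <;> simp <;> fun_prop

theorem continuous_lowerUnipotent :
    Continuous (lowerUnipotent : R → SpecialLinearGroup (Fin 2) R) := by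
  refine continuous_induced_rng.2 (continuous_matrix fun i j => ?_)
  fin_cases i <;> fin_cases j <;> simp <;> fun_prop

end unipotentTopology

section density

theorem natCast_inv_mem_ZinvP {p : ℕ} (hp : p ∈ P) : ((p : ℚ))⁻¹ ∈ ZinvP P :=
  Subring.subset_closure ⟨p, hp, rfl⟩

theorem padicNorm_le_one_of_mem_ZinvP {x : ℚ} (hx : x ∈ ZinvP P) {q : ℕ} [Fact q.Prime]
    (hq : q ∉ P) : ‖(x : ℚ_[q])‖ ≤ 1 := by
  induction hx using Subring.closure_induction with
  | mem x hx =>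
    obtain ⟨p, hp, rfl⟩ := hx
    have : Fact p.Prime := inferInstanceAs (Fact (Nat.Prime ((⟨p, hp⟩ : ↥P) : ℕ)))
    have hcop : q.Coprime p := (Nat.coprime_primes Fact.out Fact.out).2 fun h => hq (h ▸ hp)
    push_cast
    rw [norm_inv, Padic.norm_natCast_eq_one_iff.2 hcop, inv_one]
  | zero => simp
  | one => simp
  | add x y _ _ hx hy =>
    push_cast
    exact (Padic.nonarchimedean _ _).trans (max_le hx hy)
  | neg x _ hx => simpa using hx
  | mul x y _ _ hx hy =>
    push_cast
    rw [norm_mul]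
    exact mul_le_one₀ hx (norm_nonneg _) hy

theorem Rat.exists_intCast_eq_of_forall_padicNorm_le_one {x : ℚ}
    (hx : ∀ (q : ℕ) [Fact q.Prime], ‖(x : ℚ_[q])‖ ≤ 1) : ∃ n : ℤ, x = n := by
  have hden : x.den = 1 := by
    by_contra h
    obtain ⟨q, hq, hqx⟩ := Nat.exists_prime_and_dvd h
    have : Fact q.Prime := ⟨hq⟩
    have hnum : ¬ (q : ℤ) ∣ x.num := fun hn =>
      hq.one_lt.ne' (Nat.eq_one_of_dvd_coprimes x.reduced (Int.natCast_dvd.1 hn) hqx)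
    have h1 := hx q
    have h2 : (x : ℚ_[q]) * x.den = x.num := by exact_mod_cast Rat.mul_den_eq_num x
    have h3 : ‖(x.num : ℚ_[q])‖ < 1 := by
      rw [← h2, norm_mul]
      have : ‖((x.den : ℕ) : ℚ_[q])‖ < 1 := Padic.norm_natCast_lt_one_iff.2 hqx
      nlinarith [norm_nonneg (x : ℚ_[q]), norm_nonneg ((x.den : ℕ) : ℚ_[q])]
    exact hnum (Padic.norm_intCast_lt_one_iff.1 h3)
  exact ⟨x.num, by rw [← Rat.num_div_den x]; simp [hden]⟩

/-- An element of `ℤ[1/P]` which is `p`-integral for all `p ∈ P` is an integer. -/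
theorem exists_intCast_eq_of_mem_ZinvP {x : ℚ} (hx : x ∈ ZinvP P)
    (h : ∀ p : ↥P, ‖(x : ℚ_[(p : ℕ)])‖ ≤ 1) : ∃ n : ℤ, x = n := by
  refine Rat.exists_intCast_eq_of_forall_padicNorm_le_one fun q _ => ?_
  by_cases hq : q ∈ P
  · exact h ⟨q, hq⟩
  · exact padicNorm_le_one_of_mem_ZinvP P hx hq

theorem exists_mem_ZinvP_approx (p : ↥P) (x : ℚ_[(p : ℕ)]) {ε : ℝ} (hε : 0 < ε) :
    ∃ y ∈ ZinvP P, ‖(y : ℚ_[(p : ℕ)]) - x‖ < ε ∧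
      ∀ q : ↥P, q ≠ p → ‖(y : ℚ_[(q : ℕ)])‖ < ε := by
  obtain ⟨M, hM⟩ := exists_pow_lt_of_lt_one hε (by norm_num : (1 / 2 : ℝ) < 1)
  let N : ℕ := ∏ r ∈ Finset.univ.erase p, (r : ℕ) ^ M
  have hNp : ‖(N : ℚ_[(p : ℕ)])‖ = 1 := by
    rw [Padic.norm_natCast_eq_one_iff]
    refine Nat.Coprime.prod_right fun r hr => Nat.Coprime.pow_right _ ?_
    exact (Nat.coprime_primes Fact.out Fact.out).2 fun h =>
      (Finset.mem_erase.1 hr).1 (Subtype.ext h.symm)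
  have hp1 : (1 : ℝ) < (p : ℕ) := by exact_mod_cast (Fact.out : Nat.Prime (p : ℕ)).one_lt
  have hp0 : ((p : ℕ) : ℚ_[(p : ℕ)]) ≠ 0 := by
    exact_mod_cast (Fact.out : Nat.Prime (p : ℕ)).ne_zero
  have hN0 : (N : ℚ_[(p : ℕ)]) ≠ 0 := norm_ne_zero_iff.1 (by rw [hNp]; exact one_ne_zero)
  obtain ⟨n, hn⟩ := pow_unbounded_of_one_lt ‖x‖ hp1
  have hu : ‖((p : ℕ) : ℚ_[(p : ℕ)]) ^ n * x / N‖ ≤ 1 := by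
    rw [norm_div, hNp, div_one, norm_mul, norm_pow, Padic.norm_p, inv_pow,
      inv_mul_le_iff₀ (by positivity)]
    linarith
  let u : ℤ_[(p : ℕ)] := ⟨_, hu⟩
  obtain ⟨m, hm⟩ := (PadicInt.denseRange_intCast (p := p)).exists_dist_lt
    (u : ℤ_[(p : ℕ)]) (ε := ε / (p : ℕ) ^ n) (by positivity)
  have hm' : ‖(m : ℚ_[(p : ℕ)]) - (p : ℕ) ^ n * x / N‖ < ε / (p : ℕ) ^ n := by
    rw [dist_comm, dist_eq_norm, PadicInt.norm_def, PadicInt.coe_sub,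
      PadicInt.coe_intCast] at hm
    exact hm
  refine ⟨m * N * ((p : ℚ)⁻¹) ^ n, ?_, ?_, fun q hq => ?_⟩
  · exact mul_mem (mul_mem (intCast_mem _ _) (natCast_mem _ _))
      (pow_mem (natCast_inv_mem_ZinvP P p.2) _)
  · have : ((m * N * ((p : ℚ)⁻¹) ^ n : ℚ) : ℚ_[(p : ℕ)]) - x =
        N * (((p : ℕ) : ℚ_[(p : ℕ)])⁻¹) ^ n * (m - (p : ℕ) ^ n * x / N) := by
      push_cast
      rw [inv_pow]
      field_simp
    rw [this, norm_mul, norm_mul, hNp, norm_pow, norm_inv, Padic.norm_p, inv_inv, one_mul]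
    rwa [lt_div_iff₀' (by positivity)] at hm'
  · have hpq : ‖((p : ℕ) : ℚ_[(q : ℕ)])‖ = 1 := by
      rw [Padic.norm_natCast_eq_one_iff]
      exact (Nat.coprime_primes Fact.out Fact.out).2 fun h => hq (Subtype.ext h)
    have hq2 : (2 : ℝ) ≤ (q : ℕ) := by exact_mod_cast (Fact.out : Nat.Prime (q : ℕ)).two_le
    have hNq : ‖(N : ℚ_[(q : ℕ)])‖ ≤ ((q : ℕ) : ℝ) ^ (-(M : ℤ)) := by
      have := (Padic.norm_int_le_pow_iff_dvd (p := q) (N : ℤ) M).2 (by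
        exact_mod_cast Finset.dvd_prod_of_mem (fun r : ↥P => (r : ℕ) ^ M)
          (Finset.mem_erase.2 ⟨hq, Finset.mem_univ q⟩))
      simpa using this
    push_cast
    rw [norm_mul, norm_mul, norm_pow, norm_inv, hpq, inv_one, one_pow, mul_one]
    calc ‖(m : ℚ_[(q : ℕ)])‖ * ‖(N : ℚ_[(q : ℕ)])‖
        ≤ 1 * ((q : ℕ) : ℝ) ^ (-(M : ℤ)) := by
          gcongr
          exact Padic.norm_int_le_one m
      _ ≤ (1 / 2) ^ M := by
          rw [one_mul, _root_.zpow_neg, zpow_natCast, one_div, inv_pow]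
          gcongr
      _ < ε := hM

/-- Strong approximation for the additive group. -/
theorem denseRange_ZinvP :
    DenseRange fun (x : ZinvP P) (p : ↥P) => ((x : ℚ) : ℚ_[(p : ℕ)]) := by
  let φ : ZinvP P →+ ((p : ↥P) → ℚ_[(p : ℕ)]) :=
    ((RingHom.pi fun p : ↥P => Rat.castHom ℚ_[(p : ℕ)]).comp (ZinvP P).subtype).toAddMonoidHom
  have hsingle : ∀ (p : ↥P) (x : ℚ_[(p : ℕ)]), Pi.single p x ∈ φ.range.topologicalClosure := by
    intro p x
    refine Metric.mem_closure_iff.2 fun ε hε => ?_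
    obtain ⟨y, hy, hyp, hyq⟩ := exists_mem_ZinvP_approx P p x hε
    refine ⟨φ ⟨y, hy⟩, ⟨_, rfl⟩, (dist_pi_lt_iff hε).2 fun q => ?_⟩
    rw [dist_comm, dist_eq_norm]
    change ‖(y : ℚ_[(q : ℕ)]) - _‖ < ε
    by_cases h : q = p
    · subst h
      simpa using hyp
    · rw [Pi.single_eq_of_ne h, sub_zero]
      exact hyq q h
  intro v
  have : v ∈ φ.range.topologicalClosure := by
    rw [← Finset.univ_sum_single v]
    exact sum_mem fun p _ => hsingle p (v p)
  exact this

end density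

section topology

instance : IsTopologicalGroup (SpecialLinearGroup (Fin 2) ℝ) :=
  SpecialLinearGroup.topologicalGroup

instance : SecondCountableTopology (SpecialLinearGroup (Fin 2) ℝ) :=
  have : SecondCountableTopology (Matrix (Fin 2) (Fin 2) ℝ) :=
    inferInstanceAs (SecondCountableTopology (Fin 2 → Fin 2 → ℝ))
  TopologicalSpace.Subtype.secondCountableTopology {A : Matrix (Fin 2) (Fin 2) ℝ | A.det = 1}

instance : LocallyCompactSpace (SpecialLinearGroup (Fin 2) ℝ) :=
  have : LocallyCompactSpace (Matrix (Fin 2) (Fin 2) ℝ) :=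
    inferInstanceAs (LocallyCompactSpace (Fin 2 → Fin 2 → ℝ))
  SpecialLinearGroup.isClosedEmbedding_val.locallyCompactSpace

instance : BorelSpace (SpecialLinearGroup (Fin 2) ℝ) :=
  have : BorelSpace (Matrix (Fin 2) (Fin 2) ℝ) := inferInstanceAs (BorelSpace (Fin 2 → Fin 2 → ℝ))
  Subtype.borelSpace {A : Matrix (Fin 2) (Fin 2) ℝ | A.det = 1}

variable (p : ℕ) [Fact p.Prime]

instance : IsTopologicalGroup (SpecialLinearGroup (Fin 2) ℚ_[p]) :=
  SpecialLinearGroup.topologicalGroup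

instance : SecondCountableTopology (SpecialLinearGroup (Fin 2) ℚ_[p]) :=
  have : SecondCountableTopology (Matrix (Fin 2) (Fin 2) ℚ_[p]) :=
    inferInstanceAs (SecondCountableTopology (Fin 2 → Fin 2 → ℚ_[p]))
  TopologicalSpace.Subtype.secondCountableTopology {A : Matrix (Fin 2) (Fin 2) ℚ_[p] | A.det = 1}

instance : LocallyCompactSpace (SpecialLinearGroup (Fin 2) ℚ_[p]) :=
  have : LocallyCompactSpace (Matrix (Fin 2) (Fin 2) ℚ_[p]) :=
    inferInstanceAs (LocallyCompactSpace (Fin 2 → Fin 2 → ℚ_[p]))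
  SpecialLinearGroup.isClosedEmbedding_val.locallyCompactSpace

instance : BorelSpace (SpecialLinearGroup (Fin 2) ℚ_[p]) :=
  have : BorelSpace (Matrix (Fin 2) (Fin 2) ℚ_[p]) :=
    inferInstanceAs (BorelSpace (Fin 2 → Fin 2 → ℚ_[p]))
  Subtype.borelSpace {A : Matrix (Fin 2) (Fin 2) ℚ_[p] | A.det = 1}

theorem continuous_realEntry (i j : Fin 2) :
    Continuous fun g : SpecialLinearGroup (Fin 2) ℝ => g i j :=
  (continuous_subtype_val (p := fun A : Matrix (Fin 2) (Fin 2) ℝ => A.det = 1)).matrix_elem i j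

theorem continuous_padicEntry (i j : Fin 2) :
    Continuous fun g : SpecialLinearGroup (Fin 2) ℚ_[p] => g i j :=
  (continuous_subtype_val (p := fun A : Matrix (Fin 2) (Fin 2) ℚ_[p] => A.det = 1)).matrix_elem i j

/-- The matrices in `SL₂(ℚ_p)` with `p`-integral entries. -/
def padicIntegralSL : Set (SpecialLinearGroup (Fin 2) ℚ_[p]) := {g | ∀ i j, ‖g i j‖ ≤ 1}

theorem isOpen_padicIntegralSL : IsOpen (padicIntegralSL p) := by
  have : padicIntegralSL p =
      ⋂ i, ⋂ j, (fun g : SpecialLinearGroup (Fin 2) ℚ_[p] => g i j) ⁻¹' Metric.closedBall 0 1 := by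
    ext g; simp [padicIntegralSL]
  rw [this]
  exact isOpen_iInter_of_finite fun i => isOpen_iInter_of_finite fun j =>
    (IsUltrametricDist.isOpen_closedBall _ one_ne_zero).preimage (continuous_padicEntry p i j)

theorem isCompact_padicIntegralSL : IsCompact (padicIntegralSL p) := by
  have h : IsCompact (Set.univ.pi fun _ : Fin 2 => Set.univ.pi fun _ : Fin 2 =>
      Metric.closedBall (0 : ℚ_[p]) 1) :=
    isCompact_univ_pi fun _ => isCompact_univ_pi fun _ => isCompact_closedBall _ _
  rw [show padicIntegralSL p = (fun g : SpecialLinearGroup (Fin 2) ℚ_[p] => g.1) ⁻¹'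
      (Set.univ.pi fun _ => Set.univ.pi fun _ => Metric.closedBall 0 1) from
    Set.ext fun g => ⟨fun hg i _ j _ => mem_closedBall_zero_iff.2 (hg i j),
      fun hg i j => mem_closedBall_zero_iff.1 (hg i trivial j trivial)⟩]
  exact SpecialLinearGroup.isClosedEmbedding_val.isCompact_preimage h

variable {p}

theorem mul_mem_padicIntegralSL {g h : SpecialLinearGroup (Fin 2) ℚ_[p]}
    (hg : g ∈ padicIntegralSL p) (hh : h ∈ padicIntegralSL p) : g * h ∈ padicIntegralSL p := by
  intro i j
  have hmul : (g * h) i j = g i 0 * h 0 j + g i 1 * h 1 j := by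
    simp [Matrix.mul_apply, Fin.sum_univ_two]
  change ‖(g * h) i j‖ ≤ 1
  rw [hmul]
  refine (Padic.nonarchimedean _ _).trans (max_le ?_ ?_) <;> rw [norm_mul] <;>
    exact mul_le_one₀ (hg _ _) (norm_nonneg _) (hh _ _)

theorem map_intCast_mem_padicIntegralSL (γ : SpecialLinearGroup (Fin 2) ℤ) :
    SpecialLinearGroup.map (Int.castRingHom ℚ_[p]) γ ∈ padicIntegralSL p := fun i j => by
  simpa using Padic.norm_int_le_one (p := p) (γ i j)

end topology

section lattice

open UpperHalfPlane

/-- The set of `g ∈ SL₂(ℝ)` moving `i` into a cuspidal strip. -/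
def siegelSet : Set (SpecialLinearGroup (Fin 2) ℝ) :=
  {g | g • I ∈ {z : ℍ | z.re ∈ Set.Ico 0 1 ∧ 1 / 2 ≤ z.im}}

theorem measure_siegelSet_lt_top (ν : Measure (SpecialLinearGroup (Fin 2) ℝ)) [ν.IsHaarMeasure] :
    ν siegelSet < ⊤ := by
  have hcont : Continuous fun g : SpecialLinearGroup (Fin 2) ℝ => g • I :=
    isProperMap_smul_I.continuous
  let m : Measure ℍ := ν.map fun g => g • I
  have hinv : SMulInvariantMeasure (SpecialLinearGroup (Fin 2) ℝ) ℍ m := ⟨fun c s hs => by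
    have hcs : Continuous fun z : ℍ => c • z := continuous_const_smul c
    rw [Measure.map_apply hcont.measurable hs,
      Measure.map_apply hcont.measurable (hcs.measurable hs),
      ← measure_preimage_mul ν c ((fun g => g • I) ⁻¹' s)]
    congr 1
    ext g
    simp [mul_smul]⟩
  have hfin : IsFiniteMeasureOnCompacts m := ⟨fun K hK => by
    rw [Measure.map_apply hcont.measurable hK.measurableSet]
    have hc : IsCompact ((fun g : SpecialLinearGroup (Fin 2) ℝ => g • I) ⁻¹' K) :=
      isProperMap_smul_I.isCompact_preimage hK
    exact hc.measure_lt_top⟩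
  exact (Measure.le_map_apply hcont.aemeasurable _).trans_lt
    (measure_strip_lt_top m (by norm_num : (0 : ℝ) < 1 / 2))

/-- Strong approximation: `SL₂(ℤ[1/P])` is dense in `∏ SL₂(ℚ_p)`. -/
theorem exists_inv_mul_mem_padicIntegralSL
    (g : (p : ↥P) → SpecialLinearGroup (Fin 2) ℚ_[(p : ℕ)]) :
    ∃ A : SpecialLinearGroup (Fin 2) (ZinvP P), ∀ p : ↥P,
      (SpecialLinearGroup.map ((Rat.castHom ℚ_[(p : ℕ)]).comp (ZinvP P).subtype) A)⁻¹ * g p ∈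
        padicIntegralSL p := by
  let φ : SpecialLinearGroup (Fin 2) (ZinvP P) →*
      ((p : ↥P) → SpecialLinearGroup (Fin 2) ℚ_[(p : ℕ)]) :=
    MonoidHom.pi fun p => SpecialLinearGroup.map
      ((Rat.castHom ℚ_[(p : ℕ)]).comp (ZinvP P).subtype)
  let T := φ.range.topologicalClosure
  have hT : IsClosed (T : Set ((p : ↥P) → SpecialLinearGroup (Fin 2) ℚ_[(p : ℕ)])) :=
    φ.range.isClosed_topologicalClosure
  have hU : ∀ v : (p : ↥P) → ℚ_[(p : ℕ)], (fun p => upperUnipotent (v p)) ∈ T := fun v => by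
    refine (denseRange_ZinvP P).induction_on v (hT.preimage (continuous_pi fun p =>
      continuous_upperUnipotent.comp (continuous_apply p))) fun x => ?_
    refine φ.range.le_topologicalClosure ⟨upperUnipotent x, ?_⟩
    ext1 p
    exact map_upperUnipotent _ _
  have hL : ∀ v : (p : ↥P) → ℚ_[(p : ℕ)], (fun p => lowerUnipotent (v p)) ∈ T := fun v => by
    refine (denseRange_ZinvP P).induction_on v (hT.preimage (continuous_pi fun p =>
      continuous_lowerUnipotent.comp (continuous_apply p))) fun x => ?_
    refine φ.range.le_topologicalClosure ⟨lowerUnipotent x, ?_⟩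
    ext1 p
    exact map_lowerUnipotent _ _
  have hg : g ∈ closure (φ.range : Set _) := by
    choose s x y z h using fun p => exists_eq_lower_mul_upper_mul_lower_mul_upper (g p)
    rw [show g = (fun p => lowerUnipotent (s p)) * (fun p => upperUnipotent (x p)) *
      (fun p => lowerUnipotent (y p)) * (fun p => upperUnipotent (z p)) from funext h]
    exact T.mul_mem (T.mul_mem (T.mul_mem (hL s) (hU x)) (hL y)) (hU z)
  have hopen : IsOpen {h : (p : ↥P) → SpecialLinearGroup (Fin 2) ℚ_[(p : ℕ)] |
      ∀ p : ↥P, (h p)⁻¹ * g p ∈ padicIntegralSL p} := by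
    simp only [Set.ofPred_forall]
    exact isOpen_iInter_of_finite fun p => (isOpen_padicIntegralSL (p : ℕ)).preimage
      (((continuous_apply p).inv).mul continuous_const)
  obtain ⟨_, hA, A, rfl⟩ := mem_closure_iff.1 hg _ hopen fun p => by
    simpa using map_intCast_mem_padicIntegralSL (p := p) 1
  exact ⟨A, hA⟩

theorem discreteTopology_ΓP : DiscreteTopology (ΓP P) := by
  refine discreteTopology_of_isOpen_singleton_one ?_
  let U : Set (GP P) := {g | (∀ i j, |g.1 i j - (1 : Matrix (Fin 2) (Fin 2) ℝ) i j| < 1) ∧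
    ∀ p : ↥P, g.2 p ∈ padicIntegralSL p}
  have hU : IsOpen U := by
    have h1 : IsOpen {g : GP P | ∀ i j, |g.1 i j - (1 : Matrix (Fin 2) (Fin 2) ℝ) i j| < 1} := by
      simp only [Set.ofPred_forall]
      refine isOpen_iInter_of_finite fun i => isOpen_iInter_of_finite fun j => ?_
      have := (continuous_realEntry i j).comp (continuous_fst (X := SpecialLinearGroup (Fin 2) ℝ)
        (Y := (p : ↥P) → SpecialLinearGroup (Fin 2) ℚ_[(p : ℕ)]))
      exact isOpen_lt (this.sub continuous_const).abs continuous_const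
    have h2 : IsOpen {g : GP P | ∀ p : ↥P, g.2 p ∈ padicIntegralSL p} := by
      simp only [Set.ofPred_forall]
      exact isOpen_iInter_of_finite fun p => (isOpen_padicIntegralSL (p : ℕ)).preimage
        ((continuous_apply p).comp continuous_snd)
    exact h1.inter h2
  refine isOpen_induced_iff.2 ⟨U, hU, Set.ext fun ⟨g, hg⟩ => ?_⟩
  simp only [Set.mem_preimage, Set.mem_singleton_iff, Subgroup.mk_eq_one]
  constructor
  · rintro ⟨h1, h2⟩
    obtain ⟨A, rfl⟩ := hg
    suffices A = 1 by rw [this, map_one]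
    ext i j
    obtain ⟨n, hn⟩ := exists_intCast_eq_of_mem_ZinvP P (A i j).2 fun p => h2 p i j
    have h3 : |((A i j : ℚ) : ℝ) - (1 : Matrix (Fin 2) (Fin 2) ℝ) i j| < 1 := h1 i j
    rw [hn]
    rw [hn, Rat.cast_intCast] at h3
    have h4 : (1 : Matrix (Fin 2) (Fin 2) ℝ) i j = ((1 : Matrix (Fin 2) (Fin 2) ℤ) i j : ℤ) := by
      simp [Matrix.one_apply]
    rw [h4] at h3
    have h5 : |n - (1 : Matrix (Fin 2) (Fin 2) ℤ) i j| < 1 := by exact_mod_cast h3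
    rw [Int.abs_lt_one_iff, sub_eq_zero] at h5
    rw [h5]
    simp [Matrix.one_apply]
    split_ifs <;> simp
  · rintro rfl
    refine ⟨fun i j => by simp, fun p => ?_⟩
    simpa using map_intCast_mem_padicIntegralSL (p := p) 1

theorem exists_mem_ΓP_mul_mem (g : GP P) :
    ∃ γ ∈ ΓP P, γ * g ∈ siegelSet ×ˢ Set.univ.pi fun p : ↥P => padicIntegralSL (p : ℕ) := by
  obtain ⟨A, hA⟩ := exists_inv_mul_mem_padicIntegralSL P g.2
  obtain ⟨γ, hγ⟩ := exists_smul_mem_strip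
    (((SpecialLinearGroup.map ((Rat.castHom ℝ).comp (ZinvP P).subtype) A)⁻¹ * g.1) • I)
  let B : SpecialLinearGroup (Fin 2) (ZinvP P) :=
    SpecialLinearGroup.map (Int.castRingHom (ZinvP P)) γ
  have hB : ∀ {R : Type} [CommRing R] (f : ZinvP P →+* R),
      SpecialLinearGroup.map f B = SpecialLinearGroup.map (Int.castRingHom R) γ := by
    intro R _ f
    ext i j
    simp [B]
  refine ⟨_, ⟨B * A⁻¹, rfl⟩, ?_, fun p _ => ?_⟩
  · have : SpecialLinearGroup.map ((Rat.castHom ℝ).comp (ZinvP P).subtype) (B * A⁻¹) * g.1 ∈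
        siegelSet := by
      rw [map_mul, map_inv, hB, mul_assoc]
      simpa only [siegelSet, Set.mem_ofPred_eq, mul_smul] using hγ
    exact this
  · have : SpecialLinearGroup.map ((Rat.castHom ℚ_[(p : ℕ)]).comp (ZinvP P).subtype) (B * A⁻¹) *
        g.2 p ∈ padicIntegralSL (p : ℕ) := by
      rw [map_mul, map_inv, hB, mul_assoc]
      exact mul_mem_padicIntegralSL (map_intCast_mem_padicIntegralSL γ) (hA p)
    exact this

theorem monoidHom_GP_eq_one {A : Type*} [CommMonoid A] (χ : GP P →* A) : χ = 1 := by
  have h1 : χ.comp (MonoidHom.inl _ _) = 1 := SpecialLinearGroup.monoidHom_eq_one _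
  have h2 : χ.comp (MonoidHom.inr _ _) = 1 := by
    classical
    refine MonoidHom.pi_ext fun p x => ?_
    exact DFunLike.congr_fun (SpecialLinearGroup.monoidHom_eq_one
      ((χ.comp (MonoidHom.inr _ _)).comp (MonoidHom.mulSingle
        (fun p : ↥P => SpecialLinearGroup (Fin 2) ℚ_[(p : ℕ)]) p))) x
  refine MonoidHom.ext fun g => ?_
  have := congrArg₂ (· * ·) (DFunLike.congr_fun h1 g.1) (DFunLike.congr_fun h2 g.2)
  simpa [← map_mul] using this

end lattice

/-- `Δ(SL₂(ℤ[1/P]))` is a discrete subgroup of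
`G = SL₂(ℝ) × ∏_{p∈P} SL₂(ℚ_p)`, and there exists a right-translation-invariant Borel
probability measure on `Δ(SL₂(ℤ[1/P]))\G`; that is, `SL₂(ℤ[1/P])` is a lattice in `G`. -/
theorem sl2_ZinvP_is_lattice :
    DiscreteTopology (ΓP P) ∧
      ∃ μ : Measure (XP P), IsProbabilityMeasure μ ∧
        ∀ g : GP P, Measure.map (rightTP P g) μ = μ := by
  have hΓ := discreteTopology_ΓP P
  refine ⟨hΓ, ?_⟩
  let ν₁ : Measure (SpecialLinearGroup (Fin 2) ℝ) := Measure.haar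
  let ν₂ : Measure ((p : ↥P) → SpecialLinearGroup (Fin 2) ℚ_[(p : ℕ)]) := Measure.haar
  let ν : Measure (GP P) := ν₁.prod ν₂
  have : ν.IsMulRightInvariant :=
    Measure.isMulRightInvariant_of_modularCharacter_eq_one (monoidHom_GP_eq_one P _) ν
  have hF : ν (siegelSet ×ˢ Set.univ.pi fun p : ↥P => padicIntegralSL (p : ℕ)) ≠ ⊤ := by
    rw [Measure.prod_prod]
    exact (ENNReal.mul_lt_top (measure_siegelSet_lt_top ν₁)
      (isCompact_univ_pi fun p : ↥P => isCompact_padicIntegralSL (p : ℕ)).measure_lt_top).ne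
  obtain ⟨μ, hμ, hinv⟩ := (ΓP P).exists_isProbabilityMeasure_map_eq ν (NeZero.ne ν) hF
    (exists_mem_ΓP_mul_mem P)
  exact ⟨μ, hμ, fun g => hinv g _ fun _ => rfl⟩

end
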